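/- Let γ : ℝ × (-∞,0] → ℝ² be an ancient complete non-compact embedded smooth curve shortening flow and let θ : ℝ × (-∞,0] → ℝ be a smooth angle function. Then the range of the angle is non-increasing in time: for all t₁ < t₂ ≤ 0, the set {θ(u,t₂) : u ∈ ℝ} is contained in the set {θ(u,t₁) : u ∈ ℝ}. -/

import Mathlib

open Real MeasureTheory Set Filter
open scoped RealInnerProductSpace ENNReal

noncomputable section

/-- The Euclidean plane. -/
abbrev R2 := EuclideanSpace ℝ (Fin 2)

/-- The point of `ℝ²` with coordinates `(x, y)`. -/
def toR2 (x y : ℝ) : R2 := (WithLp.equiv 2 (Fin 2 → ℝ)).symm ![x, y]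

/-- Counterclockwise rotation of the plane by `π/2`. -/
def Jrot (v : R2) : R2 := toR2 (-(v 1)) (v 0)

/-- Arclength derivative `∂ₛ := |∂ᵤγ|⁻¹ ∂ᵤ` along the time-`t` curve of the flow `γ`,
applied to a function `f` of `(u, t)`. -/
def aderiv (γ : ℝ → ℝ → R2) {F : Type} [NormedAddCommGroup F] [NormedSpace ℝ F]
    (f : ℝ → ℝ → F) (u t : ℝ) : F :=
  ‖deriv (fun v => γ v t) u‖⁻¹ • deriv (fun v => f v t) u

/-- The unit tangent `T = ∂ᵤγ / |∂ᵤγ|`. -/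
def unitT (γ : ℝ → ℝ → R2) (u t : ℝ) : R2 := aderiv γ γ u t

/-- The unit normal `n = J T`. -/
def unitN (γ : ℝ → ℝ → R2) (u t : ℝ) : R2 := Jrot (unitT γ u t)

/-- The signed curvature `κ = ⟨∂ₛT, n⟩`. -/
def curv (γ : ℝ → ℝ → R2) (u t : ℝ) : ℝ := ⟪aderiv γ (unitT γ) u t, unitN γ u t⟫

/-- `γ : ℝ × I → ℝ²` is a smooth curve shortening flow in fixed-parametrization form:
smooth, regular (`∂ᵤγ ≠ 0`), and `∂ₜγ = ∂ₛ(∂ₛγ)` (time derivative taken within `I`). -/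
structure IsCSF (γ : ℝ → ℝ → R2) (I : Set ℝ) : Prop where
  smooth : ContDiffOn ℝ (⊤ : ℕ∞) (fun p : ℝ × ℝ => γ p.1 p.2) (univ ×ˢ I)
  regular : ∀ (u : ℝ), ∀ t ∈ I, deriv (fun v => γ v t) u ≠ 0
  flow : ∀ (u : ℝ), ∀ t ∈ I, derivWithin (fun s => γ u s) I t = aderiv γ (aderiv γ γ) u t

/-- The Gaussian weighted length `F_{x₀,l}` of the time-`t` curve (as an extended real). -/
def gaussLenE (γ : ℝ → ℝ → R2) (x₀ : R2) (l t : ℝ) : ℝ≥0∞ :=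
  (ENNReal.ofReal (Real.sqrt (4 * π * l)))⁻¹ *
    ∫⁻ u : ℝ, ENNReal.ofReal
      (Real.exp (-‖γ u t - x₀‖ ^ 2 / (4 * l)) * ‖deriv (fun v => γ v t) u‖)

/-- The total curvature of the time-`t` curve (as an extended real). -/
def totalCurvE (γ : ℝ → ℝ → R2) (t : ℝ) : ℝ≥0∞ :=
  ∫⁻ u : ℝ, ENNReal.ofReal (|curv γ u t| * ‖deriv (fun v => γ v t) u‖)

/-- The entropy of the flow: the supremum of the Gaussian weighted lengths over all
times `t ∈ I`, centers `x₀ ∈ ℝ²` and scales `l > 0`. -/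
def entropyE (γ : ℝ → ℝ → R2) (I : Set ℝ) : ℝ≥0∞ :=
  ⨆ t ∈ I, ⨆ x₀ : R2, ⨆ l ∈ Ioi (0:ℝ), gaussLenE γ x₀ l t

/-- The space-time domain of an ancient flow. -/
abbrev RAS : Set (ℝ × ℝ) := univ ×ˢ Iic (0:ℝ)

/-- Abstract evolution data of the angle along the flow. -/
structure RAData (v θ κ k1 v1 : ℝ → ℝ → ℝ) : Prop where
  cv : ContinuousOn (fun p : ℝ × ℝ => v p.1 p.2) RAS
  cθ : ContinuousOn (fun p : ℝ × ℝ => θ p.1 p.2) RAS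
  cκ : ContinuousOn (fun p : ℝ × ℝ => κ p.1 p.2) RAS
  ck1 : ContinuousOn (fun p : ℝ × ℝ => k1 p.1 p.2) RAS
  cv1 : ContinuousOn (fun p : ℝ × ℝ => v1 p.1 p.2) RAS
  vpos : ∀ u t, t ≤ 0 → 0 < v u t
  dθ : ∀ u t, t ≤ 0 → HasDerivAt (fun x => θ x t) (κ u t * v u t) u
  dκ : ∀ u t, t ≤ 0 → HasDerivAt (fun x => κ x t) (k1 u t) u
  dv : ∀ u t, t ≤ 0 → HasDerivAt (fun x => v x t) (v1 u t) u
  dtθ : ∀ u t, t ≤ 0 → HasDerivWithinAt (fun s => θ u s) (k1 u t / v u t) (Iic 0) t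
  dtv : ∀ u t, t ≤ 0 → HasDerivWithinAt (fun s => v u s) (-(κ u t ^ 2 * v u t)) (Iic 0) t
  infR : ∀ t, t ≤ 0 → ∀ a C : ℝ, ∃ b, a < b ∧ C < ∫ x in a..b, v x t
  infL : ∀ t, t ≤ 0 → ∀ a C : ℝ, ∃ b, b < a ∧ C < ∫ x in b..a, v x t

lemma ra_ext {F : ℝ → ℝ → ℝ} (hF : ContinuousOn (fun p : ℝ × ℝ => F p.1 p.2) RAS) :
    Continuous (fun p : ℝ × ℝ => F p.1 (min p.2 0)) := by
  have : Continuous (fun p : ℝ × ℝ => ((p.1, min p.2 0) : ℝ × ℝ)) := by fun_prop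
  exact hF.comp_continuous this (fun p => ⟨mem_univ _, min_le_right p.2 0⟩)

lemma ra_slice {F : ℝ → ℝ → ℝ} (hF : ContinuousOn (fun p : ℝ × ℝ => F p.1 p.2) RAS)
    {t : ℝ} (ht : t ≤ 0) : Continuous (fun x => F x t) := by
  have : Continuous (fun x : ℝ => ((x, t) : ℝ × ℝ)) := by fun_prop
  exact hF.comp_continuous this (fun p => ⟨mem_univ _, ht⟩)

lemma ra_slice_t {F : ℝ → ℝ → ℝ} (hF : ContinuousOn (fun p : ℝ × ℝ => F p.1 p.2) RAS)
    (u : ℝ) : ContinuousOn (fun t => F u t) (Iic 0) := by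
  have : ContinuousOn (fun t : ℝ => ((u, t) : ℝ × ℝ)) (Iic 0) := by fun_prop
  exact hF.comp this (fun p hp => ⟨mem_univ _, hp⟩)

lemma ra_int_cont {F : ℝ → ℝ → ℝ} (hF : ContinuousOn (fun p : ℝ × ℝ => F p.1 p.2) RAS)
    (a : ℝ) : ContinuousOn (fun p : ℝ × ℝ => ∫ x in a..p.1, F x p.2) RAS := by
  have h1 := ra_ext hF
  have h2 : Continuous (fun p : ℝ × ℝ => ∫ x in a..p.1, F x (min p.2 0)) := by
    apply intervalIntegral.continuous_parametric_intervalIntegral_of_continuous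
      (f := fun (p : ℝ × ℝ) x => F x (min p.2 0))
    · exact h1.comp (g := fun p : ℝ × ℝ => F p.1 (min p.2 0))
        (f := fun q : (ℝ × ℝ) × ℝ => ((q.2, q.1.2) : ℝ × ℝ)) (by fun_prop)
    · fun_prop
  refine h2.continuousOn.congr ?_
  intro p hp
  have : min p.2 0 = p.2 := min_eq_left hp.2
  simp [this]

lemma ra_int_deriv {F F' : ℝ → ℝ → ℝ} (hF : ContinuousOn (fun p : ℝ × ℝ => F p.1 p.2) RAS)
    (hF' : ContinuousOn (fun p : ℝ × ℝ => F' p.1 p.2) RAS)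
    (hd : ∀ x t, t < 0 → HasDerivAt (fun s => F x s) (F' x t) t) (a b : ℝ) {t : ℝ} (ht : t < 0) :
    HasDerivAt (fun s => ∫ x in a..b, F x s) (∫ x in a..b, F' x t) t := by
  have hK : IsCompact (uIcc a b ×ˢ Icc (2 * t) (t / 2)) := isCompact_uIcc.prod isCompact_Icc
  have hsub : uIcc a b ×ˢ Icc (2 * t) (t / 2) ⊆ RAS := by
    rintro ⟨x, s⟩ ⟨_, hs⟩
    exact ⟨mem_univ _, by have := hs.2; simp only [mem_Iic] at *; linarith⟩
  obtain ⟨C, hC⟩ := hK.exists_bound_of_continuousOn (hF'.mono hsub)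
  have hs : Icc (2 * t) (t / 2) ∈ nhds t := Icc_mem_nhds (by linarith) (by linarith)
  refine (intervalIntegral.hasDerivAt_integral_of_dominated_loc_of_deriv_le
    (F := fun s x => F x s) (F' := fun s x => F' x s) (bound := fun _ => C) hs ?_ ?_ ?_ ?_ ?_ ?_).2
  · filter_upwards [hs] with s hs
    exact (ra_slice hF (by linarith [hs.2])).aestronglyMeasurable
  · exact (ra_slice hF ht.le).intervalIntegrable _ _
  · exact (ra_slice hF' ht.le).aestronglyMeasurable
  · refine Eventually.of_forall fun x hx s hs => ?_
    exact hC (x, s) ⟨uIoc_subset_uIcc hx, hs⟩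
  · exact intervalIntegrable_const
  · refine Eventually.of_forall fun x hx s hs => ?_
    exact hd x s (by linarith [hs.2])

lemma RAData.dtθ_lt {v θ κ k1 v1 : ℝ → ℝ → ℝ} (D : RAData v θ κ k1 v1) (u : ℝ) {t : ℝ}
    (ht : t < 0) : HasDerivAt (fun s => θ u s) (k1 u t / v u t) t :=
  (D.dtθ u t ht.le).hasDerivAt (Iic_mem_nhds ht)

lemma RAData.dtv_lt {v θ κ k1 v1 : ℝ → ℝ → ℝ} (D : RAData v θ κ k1 v1) (u : ℝ) {t : ℝ}
    (ht : t < 0) : HasDerivAt (fun s => v u s) (-(κ u t ^ 2 * v u t)) t :=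
  (D.dtv u t ht.le).hasDerivAt (Iic_mem_nhds ht)

lemma ra_lemA {v θ κ k1 v1 : ℝ → ℝ → ℝ} (D : RAData v θ κ k1 v1)
    {H H1 H2 : ℝ → ℝ} {K : ℝ} (cH2 : Continuous H2)
    (dH : ∀ x, HasDerivAt H (H1 x) x) (dH1 : ∀ x, HasDerivAt H1 (H2 x) x)
    (H0 : ∀ x, 0 ≤ H x) (HK : ∀ x, H x ≤ K) (HH : ∀ x, 0 ≤ H2 x + H x)
    {a t1 t2 : ℝ} (h12 : t1 < t2) (h2 : t2 < 0)
    (hstart : ∀ u, a ≤ u → H (θ u t1) = 0) (hbd : ∀ t ∈ Icc t1 t2, H1 (θ a t) = 0) :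
    ∀ u, a ≤ u → H (θ u t2) = 0 := by
  have cH : Continuous H := continuous_iff_continuousAt.2 fun x => (dH x).continuousAt
  have cH1 : Continuous H1 := continuous_iff_continuousAt.2 fun x => (dH1 x).continuousAt
  have ccH := cH.comp_continuousOn D.cθ
  have ccH1 := cH1.comp_continuousOn D.cθ
  have ccH2 := cH2.comp_continuousOn D.cθ
  have cG : ContinuousOn (fun p : ℝ × ℝ => H (θ p.1 p.2) * v p.1 p.2) RAS := ccH.mul D.cv
  set G : ℝ → ℝ → ℝ := fun u t => H (θ u t) * v u t with hG
  set G' : ℝ → ℝ → ℝ := fun u t => H1 (θ u t) * k1 u t - H (θ u t) * (κ u t ^ 2 * v u t) with hG'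
  have cG' : ContinuousOn (fun p : ℝ × ℝ => G' p.1 p.2) RAS :=
    (ccH1.mul D.ck1).sub (ccH.mul ((D.cκ.pow 2).mul D.cv))
  have dG : ∀ x t, t < 0 → HasDerivAt (fun s => G x s) (G' x t) t := by
    intro x t ht
    have := ((dH (θ x t)).comp t (D.dtθ_lt x ht)).mul (D.dtv_lt x ht)
    have hv := (D.vpos x t ht.le).ne'
    refine this.congr_deriv ?_
    simp only [hG', Function.comp]
    field_simp
    ring
  set R : ℝ → ℝ → ℝ := fun u t => ∫ x in a..u, G x t with hR
  set R' : ℝ → ℝ → ℝ := fun u t => ∫ x in a..u, G' x t with hR'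
  have cR : ContinuousOn (fun p : ℝ × ℝ => R p.1 p.2) RAS := ra_int_cont cG a
  have cR' : ContinuousOn (fun p : ℝ × ℝ => R' p.1 p.2) RAS := ra_int_cont cG' a
  have dR : ∀ x t, t < 0 → HasDerivAt (fun s => R x s) (R' x t) t := fun x t ht =>
    ra_int_deriv cG cG' dG a x ht
  have G0 : ∀ x t, t ≤ 0 → 0 ≤ G x t := fun x t ht => mul_nonneg (H0 _) (D.vpos x t ht).le
  have iG : ∀ t, t ≤ 0 → ∀ b c, IntervalIntegrable (fun x => G x t) volume b c :=
    fun t ht b c => (ra_slice cG ht).intervalIntegrable _ _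
  have R0 : ∀ x t, t ≤ 0 → a ≤ x → 0 ≤ R x t := fun x t ht hx =>
    intervalIntegral.integral_nonneg hx fun y _ => G0 y t ht
  have Rmono : ∀ x y t, t ≤ 0 → x ≤ y → R x t ≤ R y t := by
    intro x y t ht hxy
    have := intervalIntegral.integral_add_adjacent_intervals (iG t ht a x) (iG t ht x y)
    have h2 : 0 ≤ ∫ z in x..y, G z t :=
      intervalIntegral.integral_nonneg hxy fun y _ => G0 y t ht
    simp only [hR]; linarith
  have R'le : ∀ x, a ≤ x → ∀ t ∈ Icc t1 t2, R' x t ≤ H1 (θ x t) * κ x t := by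
    intro x hx t ht
    have ht0 : t ≤ 0 := by linarith [ht.2]
    have cE : Continuous (fun y => H2 (θ y t) * (κ y t * v y t) * κ y t + H1 (θ y t) * k1 y t) :=
      ra_slice (F := fun y t => H2 (θ y t) * (κ y t * v y t) * κ y t + H1 (θ y t) * k1 y t)
        (((ccH2.mul (D.cκ.mul D.cv)).mul D.cκ).add (ccH1.mul D.ck1)) ht0
    have e := intervalIntegral.integral_eq_sub_of_hasDerivAt (a := a) (b := x)
      (f := fun y => H1 (θ y t) * κ y t)
      (f' := fun y => H2 (θ y t) * (κ y t * v y t) * κ y t + H1 (θ y t) * k1 y t)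
      (fun y _ => ((dH1 (θ y t)).comp y (D.dθ y t ht0)).mul (D.dκ y t ht0))
      (cE.intervalIntegrable _ _)
    simp only [hbd t ht, zero_mul, sub_zero] at e
    rw [← e]
    apply intervalIntegral.integral_mono_on hx ((ra_slice cG' ht0).intervalIntegrable _ _)
      (cE.intervalIntegrable _ _)
    intro y _
    have := mul_nonneg (HH (θ y t)) (mul_nonneg (sq_nonneg (κ y t)) (D.vpos y t ht0).le)
    simp only [hG']
    nlinarith
  -- the doubly integrated quantity
  have key : ∀ b, a ≤ b → ∫ x in a..b, R x t2 * v x t2 ≤ K * (t2 - t1) := by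
    intro b hb
    have cL : ContinuousOn (fun p : ℝ × ℝ => R p.1 p.2 * v p.1 p.2) RAS := cR.mul D.cv
    have cL' : ContinuousOn (fun p : ℝ × ℝ => R' p.1 p.2 * v p.1 p.2
        + R p.1 p.2 * (-(κ p.1 p.2 ^ 2 * v p.1 p.2))) RAS :=
      (cR'.mul D.cv).add (cR.mul ((D.cκ.pow 2).mul D.cv).neg)
    have dL : ∀ t, t < 0 → HasDerivAt (fun s => ∫ x in a..b, R x s * v x s)
        (∫ x in a..b, (R' x t * v x t + R x t * (-(κ x t ^ 2 * v x t)))) t := fun t ht =>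
      ra_int_deriv (F := fun x s => R x s * v x s)
        (F' := fun x t => R' x t * v x t + R x t * (-(κ x t ^ 2 * v x t))) cL cL'
        (fun x t ht => (dR x t ht).mul (D.dtv_lt x ht)) a b ht
    have dle : ∀ t ∈ Icc t1 t2,
        ∫ x in a..b, (R' x t * v x t + R x t * (-(κ x t ^ 2 * v x t))) ≤ K := by
      intro t ht
      have ht0 : t ≤ 0 := by linarith [ht.2]
      have cE : Continuous (fun y => H1 (θ y t) * (κ y t * v y t)) :=
        ra_slice (F := fun y t => H1 (θ y t) * (κ y t * v y t)) (ccH1.mul (D.cκ.mul D.cv)) ht0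
      have e := intervalIntegral.integral_eq_sub_of_hasDerivAt (a := a) (b := b)
        (f := fun y => H (θ y t)) (f' := fun y => H1 (θ y t) * (κ y t * v y t))
        (fun y _ => (dH (θ y t)).comp y (D.dθ y t ht0)) (cE.intervalIntegrable _ _)
      have e2 : ∫ x in a..b, (R' x t * v x t + R x t * (-(κ x t ^ 2 * v x t))) ≤
          ∫ y in a..b, H1 (θ y t) * (κ y t * v y t) := by
        apply intervalIntegral.integral_mono_on hb
          ((ra_slice (F := fun x t => R' x t * v x t + R x t * (-(κ x t ^ 2 * v x t))) cL'
            ht0).intervalIntegrable _ _) (cE.intervalIntegrable _ _)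
        intro y hy
        have h1 := mul_le_mul_of_nonneg_right (R'le y hy.1 t ht) (D.vpos y t ht0).le
        have h2 := mul_nonneg (R0 y t ht0 hy.1)
          (mul_nonneg (sq_nonneg (κ y t)) (D.vpos y t ht0).le)
        nlinarith
      have := HK (θ b t)
      have := H0 (θ a t)
      linarith
    have anti : AntitoneOn (fun t => (∫ x in a..b, R x t * v x t) - K * t) (Icc t1 t2) := by
      have dd : ∀ t, t < 0 → HasDerivAt (fun t => (∫ x in a..b, R x t * v x t) - K * t)
        ((∫ x in a..b, (R' x t * v x t + R x t * (-(κ x t ^ 2 * v x t)))) - K * 1) t :=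
        fun t ht => (dL t ht).sub ((hasDerivAt_id t).const_mul K)
      apply antitoneOn_of_deriv_nonpos (convex_Icc _ _)
      · exact fun t ht => (dd t (by linarith [ht.2])).continuousAt.continuousWithinAt
      · rw [interior_Icc]
        exact fun t ht => (dd t (by linarith [ht.2])).differentiableAt.differentiableWithinAt
      · rw [interior_Icc]
        intro t ht
        rw [(dd t (by linarith [ht.2])).deriv]
        have := dle t ⟨ht.1.le, ht.2.le⟩
        linarith
    have h := anti (left_mem_Icc.2 h12.le) (right_mem_Icc.2 h12.le) h12.le
    have hz : ∫ x in a..b, R x t1 * v x t1 = 0 := by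
      rw [intervalIntegral.integral_congr (g := fun _ => (0:ℝ)), intervalIntegral.integral_zero]
      intro x hx
      rw [uIcc_of_le hb] at hx
      have : R x t1 = 0 := by
        simp only [hR]
        rw [intervalIntegral.integral_congr (g := fun _ => (0:ℝ)), intervalIntegral.integral_zero]
        intro y hy
        rw [uIcc_of_le hx.1] at hy
        simp [hG, hstart y hy.1]
      simp [this]
    simp only [hz] at h
    linarith
  -- R vanishes at time t2
  have Rz : ∀ x, a ≤ x → R x t2 = 0 := by
    intro x hx
    by_contra hne
    have hpos : 0 < R x t2 := lt_of_le_of_ne (R0 x t2 h2.le hx) (Ne.symm hne)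
    obtain ⟨b, hb, hC⟩ := D.infR t2 h2.le x (K * (t2 - t1) / R x t2)
    have h3 := key b (hx.trans hb.le)
    have cL := ra_slice (F := fun x t => R x t * v x t) (cR.mul D.cv) h2.le
    have h4 := intervalIntegral.integral_add_adjacent_intervals
      (cL.intervalIntegrable (μ := volume) a x) (cL.intervalIntegrable (μ := volume) x b)
    have h5 : 0 ≤ ∫ y in a..x, R y t2 * v y t2 := intervalIntegral.integral_nonneg hx
      fun y hy => mul_nonneg (R0 y t2 h2.le hy.1) (D.vpos y t2 h2.le).le
    have h6 : ∫ y in x..b, R x t2 * v y t2 ≤ ∫ y in x..b, R y t2 * v y t2 := by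
      apply intervalIntegral.integral_mono_on hb.le _ (cL.intervalIntegrable _ _)
      · intro y hy
        exact mul_le_mul_of_nonneg_right (Rmono x y t2 h2.le hy.1) (D.vpos y t2 h2.le).le
      · exact (continuous_const.mul (ra_slice D.cv h2.le)).intervalIntegrable _ _
    rw [intervalIntegral.integral_const_mul] at h6
    rw [div_lt_iff₀ hpos] at hC
    nlinarith
  have cGs := ra_slice (F := G) cG h2.le
  intro u hu
  have dRu : ∀ w, HasDerivAt (fun x => R x t2) (G w t2) w := fun w =>
    intervalIntegral.integral_hasDerivAt_right (iG t2 h2.le _ _)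
      cGs.aestronglyMeasurable.stronglyMeasurableAtFilter cGs.continuousAt
  have hGu : G u t2 = 0 := by
    have h1 := (dRu u).hasDerivWithinAt (s := Ici a)
    have h2 : HasDerivWithinAt (fun x => R x t2) 0 (Ici a) u :=
      (hasDerivWithinAt_const u (Ici a) (0:ℝ)).congr (fun y hy => Rz y hy) (Rz u hu)
    exact ((uniqueDiffOn_Ici a) u hu).eq_deriv _ h1 h2
  have := (D.vpos u t2 h2.le).ne'
  simpa [hG, this] using hGu

lemma ra_max_pow (n : ℕ) (x : ℝ) :
    HasDerivAt (fun y : ℝ => (max y 0) ^ (n + 2)) ((n + 2) * (max x 0) ^ (n + 1)) x := by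
  rcases lt_trichotomy x 0 with hx | hx | hx
  · have h : (fun y : ℝ => (max y 0) ^ (n + 2)) =ᶠ[nhds x] fun _ => 0 := by
      filter_upwards [Iio_mem_nhds hx] with y hy
      simp [max_eq_right (le_of_lt (mem_Iio.1 hy))]
    refine ((hasDerivAt_const x (0:ℝ)).congr_of_eventuallyEq h).congr_deriv ?_
    simp [max_eq_right hx.le]
  · subst hx
    simp only [max_self, ne_eq, Nat.add_eq_zero_iff, one_ne_zero, and_false, not_false_eq_true,
      zero_pow, mul_zero]
    rw [hasDerivAt_iff_isLittleO]
    have h1 : (fun y : ℝ => (max y 0) ^ (n + 2)) =O[nhds 0] fun y : ℝ => y ^ (n + 2) := by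
      refine Asymptotics.isBigO_of_le _ fun y => ?_
      rw [norm_pow, norm_pow]
      refine pow_le_pow_left₀ (norm_nonneg _) ?_ _
      rw [Real.norm_eq_abs, Real.norm_eq_abs, abs_of_nonneg (le_max_right _ _)]
      exact max_le (le_abs_self y) (abs_nonneg y)
    have h2 : (fun y : ℝ => y ^ (n + 2)) =o[nhds 0] fun y : ℝ => y ^ 1 :=
      Asymptotics.isLittleO_pow_pow (by omega)
    simpa using h1.trans_isLittleO h2
  · have h : (fun y : ℝ => (max y 0) ^ (n + 2)) =ᶠ[nhds x] fun y => y ^ (n + 2) := by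
      filter_upwards [Ioi_mem_nhds hx] with y hy
      simp [max_eq_left (le_of_lt (mem_Ioi.1 hy))]
    refine ((hasDerivAt_pow (n + 2) x).congr_of_eventuallyEq h).congr_deriv ?_
    simp [max_eq_left hx.le]

lemma ra_exists_H : ∃ H H1 H2 : ℝ → ℝ, Continuous H2 ∧
    (∀ x, HasDerivAt H (H1 x) x) ∧ (∀ x, HasDerivAt H1 (H2 x) x) ∧
    (∀ x, 0 ≤ H x) ∧ (∀ x, H x ≤ 1) ∧ (∀ x, 0 ≤ H2 x + H x) ∧
    (∀ x, x ≤ 0 → H x = 0 ∧ H1 x = 0) ∧ (∀ x, H x = 0 → x ≤ 0) := by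
  have m0 : ∀ x : ℝ, 0 ≤ max x 0 := fun x => le_max_right _ _
  have pp : ∀ x : ℝ, 0 < 1 + (max x 0) ^ 3 / 4 := fun x => by have := m0 x; positivity
  have d3 : ∀ x : ℝ, HasDerivAt (fun y : ℝ => (max y 0) ^ 3 / 4) (3 * (max x 0) ^ 2 / 4) x := by
    intro x
    refine ((ra_max_pow 1 x).div_const 4).congr_deriv ?_
    norm_num
  have d2 : ∀ x : ℝ, HasDerivAt (fun y : ℝ => 3 * (max y 0) ^ 2 / 4) (3 * max x 0 / 2) x := by
    intro x
    refine (((ra_max_pow 0 x).const_mul 3).div_const 4).congr_deriv ?_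
    norm_num
    ring
  refine ⟨fun x => ((max x 0) ^ 3 / 4) / (1 + (max x 0) ^ 3 / 4),
    fun x => (3 * (max x 0) ^ 2 / 4) / (1 + (max x 0) ^ 3 / 4) ^ 2,
    fun x => (3 * max x 0 / 2) / (1 + (max x 0) ^ 3 / 4) ^ 2
      - 2 * (3 * (max x 0) ^ 2 / 4) ^ 2 / (1 + (max x 0) ^ 3 / 4) ^ 3, ?_, ?_, ?_, ?_, ?_, ?_, ?_, ?_⟩
  · have : ∀ x : ℝ, (1 + (max x 0) ^ 3 / 4) ^ 2 ≠ 0 := fun x => by have := pp x; positivity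
    have : ∀ x : ℝ, (1 + (max x 0) ^ 3 / 4) ^ 3 ≠ 0 := fun x => by have := pp x; positivity
    fun_prop (disch := assumption)
  · intro x
    refine ((d3 x).div ((d3 x).const_add 1) (pp x).ne').congr_deriv ?_
    have := (pp x).ne'
    field_simp
    ring
  · intro x
    refine ((d2 x).div (((d3 x).const_add 1).pow 2) (pow_ne_zero 2 (pp x).ne')).congr_deriv ?_
    have := (pp x).ne'
    simp only [Pi.pow_apply]
    field_simp
    ring
  · intro x
    have := m0 x
    positivity
  · intro x
    show _ / _ ≤ _
    rw [div_le_one (pp x)]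
    linarith
  · intro x
    have hm := m0 x
    have hp := pp x
    set m := max x 0
    have e : 3 * m / 2 / (1 + m ^ 3 / 4) ^ 2 - 2 * (3 * m ^ 2 / 4) ^ 2 / (1 + m ^ 3 / 4) ^ 3
        + m ^ 3 / 4 / (1 + m ^ 3 / 4) =
        (m / 4 * (6 - 3 * m ^ 3 + m ^ 2 * (1 + m ^ 3 / 4) ^ 2)) / (1 + m ^ 3 / 4) ^ 3 := by
      field_simp
      ring
    show 0 ≤ 3 * m / 2 / (1 + m ^ 3 / 4) ^ 2 - 2 * (3 * m ^ 2 / 4) ^ 2 / (1 + m ^ 3 / 4) ^ 3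
        + m ^ 3 / 4 / (1 + m ^ 3 / 4)
    rw [e]
    apply div_nonneg _ (by positivity)
    apply mul_nonneg (by positivity)
    have h1 : 0 ≤ m / 2 * (m ^ 2 - 3) ^ 2 := by positivity
    have h2 : 0 ≤ m ^ 8 / 16 := by positivity
    nlinarith [sq_nonneg (m - 9 / 4)]
  · intro x hx
    simp [max_eq_right hx]
  · intro x hx
    have hp := (pp x).ne'
    by_contra h
    push Not at h
    have hx' : max x 0 ^ 3 / 4 / (1 + max x 0 ^ 3 / 4) = 0 := hx
    rw [max_eq_left h.le] at hx'
    have : 0 < x ^ 3 / 4 / (1 + x ^ 3 / 4) := by positivity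
    linarith

lemma ra_second {f f' : ℝ → ℝ} {f'' x : ℝ} (hf : ∀ y, HasDerivAt f (f' y) y)
    (hf' : HasDerivAt f' f'' x) (hmin : IsLocalMin f x) : 0 ≤ f'' := by
  by_contra hneg
  push Not at hneg
  have e : deriv f = f' := funext fun y => (hf y).deriv
  have h0 : f' x = 0 := hmin.hasDerivAt_eq_zero (hf x)
  have hmax : IsLocalMax f x := by
    apply isLocalMax_of_deriv_deriv_neg
    · rw [e, hf'.deriv]; exact hneg
    · rw [e]; exact h0
    · exact (hf x).continuousAt
  have hc : f =ᶠ[nhds x] fun _ => f x := by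
    filter_upwards [hmin, hmax] with y h1 h2
    exact le_antisymm h2 h1
  have h1 : f' =ᶠ[nhds x] fun _ => 0 := by
    rw [← e]
    refine hc.deriv.trans ?_
    simp
  have := hf'.unique ((hasDerivAt_const x (0:ℝ)).congr_of_eventuallyEq h1)
  linarith

lemma ra_left_deriv {f : ℝ → ℝ} {d t1 t0 : ℝ} (h10 : t1 < t0)
    (hf : HasDerivWithinAt f d (Icc t1 t0) t0) (hmin : ∀ t ∈ Icc t1 t0, f t0 ≤ f t) : d ≤ 0 := by
  have h1 : IsLocalMinOn f (Icc t1 t0) t0 := by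
    filter_upwards [self_mem_nhdsWithin] with t ht using hmin t ht
  have h2 := h1.hasFDerivWithinAt_nonneg hf.hasFDerivWithinAt (y := t1 - t0)
    (sub_mem_posTangentConeAt_of_segment_subset (by
      rw [segment_symm, segment_eq_Icc h10.le]))
  have h3 : 0 ≤ (t1 - t0) * d := by simpa using h2
  nlinarith

lemma ra_alg {e x v v1 m M K κ k1 : ℝ} (he : 0 < e) (hy : 0 < 1 - x ^ 2) (hv : 0 < v) (hm : 0 < m)
    (hmv : m ≤ v) (hM : |v1 / v| ≤ M) (hK : 0 ≤ K) (hKm : K * m ^ 2 = (12 + 4 * M) ^ 2)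
    (h1 : -(k1 / v) + e * K * (1 - x ^ 2) ^ 2 ≤ 0) (h2 : κ * v = 4 * e * x * (1 - x ^ 2))
    (h3 : 0 ≤ -(k1 * v + κ * v1) - e * (12 * x ^ 2 - 4)) : False := by
  obtain ⟨r, hr⟩ : ∃ r, r = v1 / v := ⟨_, rfl⟩
  obtain ⟨k, hk⟩ : ∃ k, k = k1 / v := ⟨_, rfl⟩
  rw [← hr] at hM
  rw [← hk] at h1
  have e1 : v1 = r * v := by rw [hr]; field_simp
  have e2 : k1 = k * v := by rw [hk]; field_simp
  subst e1 e2
  obtain ⟨y, hyd⟩ : ∃ y, y = 1 - x ^ 2 := ⟨_, rfl⟩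
  rw [← hyd] at h1 h2 hy
  have a1 : e * (12 + 4 * M) ^ 2 * y ^ 2 ≤ k * v * v := by
    rw [← hKm]
    have b1 : m ^ 2 ≤ v ^ 2 := pow_le_pow_left₀ hm.le hmv 2
    have b2 : e * K * y ^ 2 * v ^ 2 ≤ k * v ^ 2 :=
      mul_le_mul_of_nonneg_right (by linarith) (by positivity)
    have b3 : e * K * y ^ 2 * m ^ 2 ≤ e * K * y ^ 2 * v ^ 2 :=
      mul_le_mul_of_nonneg_left b1 (by positivity)
    nlinarith
  have a2 : κ * (r * v) = e * (4 * (x * r) * y) := by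
    calc κ * (r * v) = (κ * v) * r := by ring
      _ = _ := by rw [h2]; ring
  have hx1 : |x| ≤ 1 := by
    rw [abs_le]
    constructor <;> nlinarith
  have a3 : -M ≤ x * r := by
    have : |x * r| ≤ 1 * M := by
      rw [abs_mul]; exact mul_le_mul hx1 hM (abs_nonneg _) zero_le_one
    have := (abs_le.1 this).1
    linarith
  have a4 : -M * y ≤ x * r * y := mul_le_mul_of_nonneg_right a3 hy.le
  have a5 : 0 ≤ e * (12 * y - 8 - (12 + 4 * M) ^ 2 * y ^ 2 - 4 * (x * r) * y) := by
    have : x ^ 2 = 1 - y := by rw [hyd]; ring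
    rw [this, a2] at h3
    nlinarith
  have a6 := nonneg_of_mul_nonneg_right a5 he
  nlinarith [sq_nonneg ((12 + 4 * M) * y - 1 / 2)]

lemma ra_lemB {v θ κ k1 v1 : ℝ → ℝ → ℝ} (D : RAData v θ κ k1 v1)
    {a t1 τ : ℝ} (h1 : t1 ≤ τ) (hτ : τ ≤ 0)
    (hle : ∀ u ∈ Icc (a - 1) (a + 1), ∀ t ∈ Icc t1 τ, θ u t ≤ 0)
    (hlt : ∀ u ∈ Icc (a - 1) (a + 1), θ u t1 < 0) : θ a τ < 0 := by
  have hK : IsCompact (Icc (a - 1) (a + 1) ×ˢ Icc t1 τ) := isCompact_Icc.prod isCompact_Icc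
  have hne : (Icc (a - 1) (a + 1)).Nonempty := nonempty_Icc.2 (by linarith)
  have hQne : (Icc (a - 1) (a + 1) ×ˢ Icc t1 τ).Nonempty := hne.prod (nonempty_Icc.2 h1)
  have hsub : Icc (a - 1) (a + 1) ×ˢ Icc t1 τ ⊆ RAS := by
    rintro ⟨x, s⟩ ⟨_, hs⟩
    exact ⟨mem_univ _, hs.2.trans hτ⟩
  obtain ⟨η, hη, hη1⟩ : ∃ η > 0, ∀ u ∈ Icc (a - 1) (a + 1), η ≤ -θ u t1 := by
    obtain ⟨x, hx, hx2⟩ := isCompact_Icc.exists_isMinOn hne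
      (ra_slice D.cθ (h1.trans hτ)).neg.continuousOn
    exact ⟨-θ x t1, by linarith [hlt x hx], fun u hu => hx2 hu⟩
  obtain ⟨m, hm, hm1⟩ : ∃ m > 0, ∀ p ∈ Icc (a - 1) (a + 1) ×ˢ Icc t1 τ, m ≤ v p.1 p.2 := by
    obtain ⟨x, hx, hx2⟩ := hK.exists_isMinOn hQne (D.cv.mono hsub)
    exact ⟨v x.1 x.2, D.vpos _ _ (hsub hx).2, fun u hu => hx2 hu⟩
  have cq : ContinuousOn (fun p : ℝ × ℝ => v1 p.1 p.2 / v p.1 p.2) RAS :=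
    D.cv1.div D.cv fun p hp => (D.vpos _ _ hp.2).ne'
  obtain ⟨M, hM⟩ := hK.exists_bound_of_continuousOn (cq.mono hsub)
  have hM0 : 0 ≤ M := by
    obtain ⟨p, hp⟩ := hQne
    exact (norm_nonneg _).trans (hM p hp)
  obtain ⟨K, hKdef⟩ : ∃ K, K = (12 + 4 * M) ^ 2 / m ^ 2 := ⟨_, rfl⟩
  have hKm : K * m ^ 2 = (12 + 4 * M) ^ 2 := by rw [hKdef]; field_simp
  have hK0 : 0 ≤ K := by rw [hKdef]; positivity
  set W : ℝ → ℝ → ℝ := fun u t =>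
    -θ u t - η * (Real.exp (-K * (t - t1)) * (1 - (u - a) ^ 2) ^ 2) with hW
  have cW : ContinuousOn (fun p : ℝ × ℝ => W p.1 p.2) RAS := by
    refine D.cθ.neg.sub (Continuous.continuousOn ?_)
    fun_prop
  have main : ∀ p ∈ Icc (a - 1) (a + 1) ×ˢ Icc t1 τ, 0 ≤ W p.1 p.2 := by
    obtain ⟨⟨x, t⟩, hp, hpmin⟩ := hK.exists_isMinOn hQne (cW.mono hsub)
    have hmin : ∀ p ∈ Icc (a - 1) (a + 1) ×ˢ Icc t1 τ, W x t ≤ W p.1 p.2 := fun p hp => hpmin hp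
    suffices h : 0 ≤ W x t from fun p hp => h.trans (hmin p hp)
    by_contra hneg
    push Not at hneg
    obtain ⟨hx, ht⟩ := hp
    simp only at hx ht
    have ht0 : t ≤ 0 := ht.2.trans hτ
    have hle' := hle x hx t ht
    have hx1 : a - 1 < x := by
      refine lt_of_le_of_ne hx.1 fun h => ?_
      rw [← h] at hneg hle'
      simp only [hW] at hneg
      have : (1 - (a - 1 - a) ^ 2) = 0 := by ring
      rw [this] at hneg
      norm_num at hneg
      linarith
    have hx2 : x < a + 1 := by
      refine lt_of_le_of_ne hx.2 fun h => ?_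
      rw [h] at hneg hle'
      simp only [hW] at hneg
      have : (1 - (a + 1 - a) ^ 2) = 0 := by ring
      rw [this] at hneg
      norm_num at hneg
      linarith
    have hy0 : 0 < 1 - (x - a) ^ 2 := by nlinarith
    have hy1 : 1 - (x - a) ^ 2 ≤ 1 := by nlinarith [sq_nonneg (x - a)]
    have htt : t1 < t := by
      refine lt_of_le_of_ne ht.1 fun h => ?_
      have h3 := hη1 x hx
      rw [← h] at hneg
      simp only [hW, sub_self, mul_zero, Real.exp_zero, one_mul] at hneg
      have : (1 - (x - a) ^ 2) ^ 2 ≤ 1 := pow_le_one₀ hy0.le hy1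
      nlinarith
    have hv := D.vpos x t ht0
    have hmv := hm1 (x, t) ⟨hx, ht⟩
    simp only at hmv
    have hMv := hM (x, t) ⟨hx, ht⟩
    rw [Real.norm_eq_abs] at hMv
    simp only at hMv
    -- time derivative
    have dt : HasDerivWithinAt (fun s => W x s)
        (-(k1 x t / v x t) - η * (Real.exp (-K * (t - t1)) * (-K * 1) * (1 - (x - a) ^ 2) ^ 2))
        (Icc t1 t) t := by
      refine HasDerivWithinAt.sub ?_ (HasDerivAt.hasDerivWithinAt ?_)
      · exact ((D.dtθ x t ht0).neg).mono fun s hs => hs.2.trans ht0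
      · exact (((((hasDerivAt_id t).sub_const t1).const_mul (-K)).exp).mul_const _).const_mul η
    have dt_le := ra_left_deriv htt dt fun s hs =>
      hmin (x, s) ⟨hx, ⟨hs.1, hs.2.trans ht.2⟩⟩
    set E := Real.exp (-K * (t - t1)) with hE
    have hE0 : 0 < E := Real.exp_pos _
    -- space derivatives
    have dq : ∀ y, HasDerivAt (fun y => (1 - (y - a) ^ 2) ^ 2)
        (-4 * (y - a) * (1 - (y - a) ^ 2)) y := by
      intro y
      refine ((((((hasDerivAt_id y).sub_const a).pow 2).const_sub 1).pow 2)).congr_deriv ?_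
      simp
      ring
    have dq2 : HasDerivAt (fun y => -4 * (y - a) * (1 - (y - a) ^ 2))
        (12 * (x - a) ^ 2 - 4) x := by
      refine ((((hasDerivAt_id x).sub_const a).const_mul (-4)).mul
        ((((hasDerivAt_id x).sub_const a).pow 2).const_sub 1)).congr_deriv ?_
      simp
      ring
    have du : ∀ y, HasDerivAt (fun y => W y t)
        (-(κ y t * v y t) - η * (E * (-4 * (y - a) * (1 - (y - a) ^ 2)))) y := fun y =>
      ((D.dθ y t ht0).neg).sub (((dq y).const_mul E).const_mul η)
    have duu : HasDerivAt (fun y => -(κ y t * v y t) - η * (E * (-4 * (y - a) * (1 - (y - a) ^ 2))))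
        (-(k1 x t * v x t + κ x t * v1 x t) - η * (E * (12 * (x - a) ^ 2 - 4))) x :=
      (((D.dκ x t ht0).mul (D.dv x t ht0)).neg).sub ((dq2.const_mul E).const_mul η)
    have hloc : IsLocalMin (fun y => W y t) x := by
      filter_upwards [Icc_mem_nhds hx1 hx2] with y hy
      exact hmin (y, t) ⟨hy, ht⟩
    have hz := hloc.hasDerivAt_eq_zero (du x)
    have hzz := ra_second du duu hloc
    -- combine
    exact ra_alg (κ := κ x t) (k1 := k1 x t) (mul_pos hη hE0) hy0 hv hm hmv hMv hK0 hKm (by linarith) (by linarith)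
      (by linarith)
  have := main (a, τ) ⟨⟨by linarith, by linarith⟩, h1, le_rfl⟩
  simp only [hW, sub_self] at this
  have h3 := Real.exp_pos (-(K * (τ - t1)))
  norm_num at this
  nlinarith [mul_pos hη h3]

lemma RAData.refl {v θ κ k1 v1 : ℝ → ℝ → ℝ} (D : RAData v θ κ k1 v1) :
    RAData (fun u t => v (-u) t) (fun u t => θ (-u) t) (fun u t => -κ (-u) t)
      (fun u t => k1 (-u) t) (fun u t => -v1 (-u) t) := by
  have cc : ∀ {F : ℝ → ℝ → ℝ}, ContinuousOn (fun p : ℝ × ℝ => F p.1 p.2) RAS →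
      ContinuousOn (fun p : ℝ × ℝ => F (-p.1) p.2) RAS := by
    intro F hF
    have h1 : ContinuousOn (fun p : ℝ × ℝ => ((-p.1, p.2) : ℝ × ℝ)) RAS := by fun_prop
    exact hF.comp h1 fun p hp => ⟨mem_univ _, hp.2⟩
  have dd : ∀ {f : ℝ → ℝ} {d u : ℝ}, HasDerivAt f d (-u) → HasDerivAt (fun x => f (-x)) (-d) u := by
    intro f d u h
    refine (h.comp u (hasDerivAt_neg u)).congr_deriv ?_
    ring
  refine ⟨cc D.cv, cc D.cθ, (cc D.cκ).neg, cc D.ck1, (cc D.cv1).neg, fun u t => D.vpos _ t,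
    ?_, ?_, ?_, ?_, ?_, ?_, ?_⟩
  · intro u t ht
    exact (dd (f := fun x => θ x t) (D.dθ (-u) t ht)).congr_deriv (by ring)
  · intro u t ht
    exact (dd (f := fun x => κ x t) (D.dκ (-u) t ht)).neg.congr_deriv (by ring)
  · intro u t ht
    exact (dd (f := fun x => v x t) (D.dv (-u) t ht))
  · intro u t ht
    exact D.dtθ (-u) t ht
  · intro u t ht
    exact (D.dtv (-u) t ht).congr_deriv (by ring)
  · intro t ht a C
    obtain ⟨b, hb, hC⟩ := D.infL t ht (-a) C
    refine ⟨-b, by linarith, ?_⟩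
    rw [intervalIntegral.integral_comp_neg (fun x => v x t), neg_neg]
    exact hC
  · intro t ht a C
    obtain ⟨b, hb, hC⟩ := D.infR t ht (-a) C
    refine ⟨-b, by linarith, ?_⟩
    rw [intervalIntegral.integral_comp_neg (fun x => v x t), neg_neg]
    exact hC

lemma RAData.shift {v θ κ k1 v1 : ℝ → ℝ → ℝ} (D : RAData v θ κ k1 v1) (α : ℝ) :
    RAData v (fun u t => θ u t - α) κ k1 v1 :=
  ⟨D.cv, D.cθ.sub continuousOn_const, D.cκ, D.ck1, D.cv1, D.vpos,
    fun u t ht => (D.dθ u t ht).sub_const α, D.dκ, D.dv,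
    fun u t ht => (D.dtθ u t ht).sub_const α, D.dtv, D.infR, D.infL⟩

lemma RAData.neg {v θ κ k1 v1 : ℝ → ℝ → ℝ} (D : RAData v θ κ k1 v1) :
    RAData v (fun u t => -θ u t) (fun u t => -κ u t) (fun u t => -k1 u t) v1 :=
  ⟨D.cv, D.cθ.neg, D.cκ.neg, D.ck1.neg, D.cv1, D.vpos,
    fun u t ht => (D.dθ u t ht).neg.congr_deriv (by ring), fun u t ht => (D.dκ u t ht).neg, D.dv,
    fun u t ht => (D.dtθ u t ht).neg.congr_deriv (by ring),
    fun u t ht => (D.dtv u t ht).congr_deriv (by ring), D.infR, D.infL⟩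

lemma ra_step {v θ κ k1 v1 : ℝ → ℝ → ℝ} (D : RAData v θ κ k1 v1) {s t : ℝ} (hst : s < t)
    (ht : t < 0) (hs : ∀ u, 0 ≤ u → θ u s ≤ 0) (h0 : ∀ r ∈ Icc s t, θ 0 r ≤ 0) :
    ∀ u, 0 ≤ u → θ u t ≤ 0 := by
  obtain ⟨H, H1, H2, c2, d0, d1, p0, p1, p2, z, z'⟩ := ra_exists_H
  intro u hu
  exact z' _ (ra_lemA D c2 d0 d1 p0 p1 p2 hst ht (fun u hu => (z _ (hs u hu)).1)
    (fun r hr => (z _ (h0 r hr)).2) u hu)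

lemma ra_lemC {v θ κ k1 v1 : ℝ → ℝ → ℝ} (D : RAData v θ κ k1 v1) {t1 t2 : ℝ} (h12 : t1 ≤ t2)
    (h2 : t2 ≤ 0) (hneg : ∀ u, θ u t1 < 0) : ∀ u, θ u t2 < 0 := by
  have hB : ∀ τ ∈ Icc t1 t2, (∀ t ∈ Icc t1 τ, ∀ u, θ u t ≤ 0) → ∀ u, θ u τ < 0 :=
    fun τ hτ h u => ra_lemB D hτ.1 (hτ.2.trans h2) (fun x _ t ht => h t ht x) (fun x _ => hneg x)
  set s : Set ℝ := {τ | ∀ t ∈ Icc t1 τ, ∀ u, θ u t ≤ 0} with hsdef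
  have key : Icc t1 t2 ⊆ s := by
    apply IsClosed.Icc_subset_of_forall_exists_gt
    · -- closedness
      rw [← isSeqClosed_iff_isClosed]
      intro τ τ0 hτ hlim
      have hτ0 : τ0 ∈ Icc t1 t2 := isClosed_Icc.isSeqClosed (fun n => (hτ n).2) hlim
      refine ⟨?_, hτ0⟩
      intro t ht u
      by_cases hex : ∃ n, t ≤ τ n
      · obtain ⟨n, hn⟩ := hex
        exact (hτ n).1 t ⟨ht.1, hn⟩ u
      · push Not at hex
        have h3 : τ0 ≤ t := le_of_tendsto' hlim fun n => (hex n).le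
        have h4 : t = τ0 := le_antisymm ht.2 h3
        subst h4
        have hc := (ra_slice_t D.cθ u) t (ht.2.trans (hτ0.2.trans h2))
        have h5 : Tendsto τ atTop (nhdsWithin t (Iic 0)) :=
          tendsto_nhdsWithin_iff.2 ⟨hlim, Eventually.of_forall fun n => (hτ n).2.2.trans h2⟩
        refine le_of_tendsto' (hc.tendsto.comp h5) fun n => ?_
        exact (hτ n).1 (τ n) ⟨(hτ n).2.1, le_rfl⟩ u
    · intro t ht u
      have : t = t1 := le_antisymm ht.2 ht.1
      rw [this]; exact (hneg u).le
    · rintro x ⟨hxs, hx⟩ y hy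
      have hx0 : x < 0 := hx.2.trans_le h2
      have hlt := hB x ⟨hx.1, hx.2.le⟩ hxs 0
      have hc : ContinuousAt (fun t => θ 0 t) x :=
        (ra_slice_t D.cθ 0).continuousAt (Iic_mem_nhds hx0)
      have hev := hc.eventually_lt continuousAt_const hlt
      obtain ⟨δ, hδ, hball⟩ := Metric.eventually_nhds_iff.1 hev
      obtain ⟨z, hz1, hz2⟩ : ∃ z, x < z ∧ z < min (min y 0) (x + δ) :=
        exists_between (by simp [hx0, hδ, mem_Ioi.1 hy])
      simp only [lt_min_iff] at hz2
      refine ⟨z, ?_, hz1, hz2.1.1.le⟩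
      intro t ht u
      by_cases htx : t ≤ x
      · exact hxs t ⟨ht.1, htx⟩ u
      · push Not at htx
        have ht0 : t < 0 := ht.2.trans_lt hz2.1.2
        have hx' : ∀ u, θ u x ≤ 0 := fun u => hxs x ⟨hx.1, le_rfl⟩ u
        have h0 : ∀ r ∈ Icc x t, θ 0 r ≤ 0 := by
          intro r hr
          refine (hball ?_).le
          rw [Real.dist_eq, abs_of_nonneg (by linarith [hr.1])]
          linarith [hr.2, ht.2, hz2.2]
        rcases le_total 0 u with hu | hu
        · exact ra_step D htx ht0 (fun u _ => hx' u) h0 u hu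
        · have := ra_step D.refl htx ht0 (fun u _ => hx' _) (by simpa using h0) (-u) (by linarith)
          simpa using this
  exact hB t2 ⟨h12, le_rfl⟩ (key ⟨h12, le_rfl⟩)

lemma ra_final {v θ κ k1 v1 : ℝ → ℝ → ℝ} (D : RAData v θ κ k1 v1) {t1 t2 : ℝ} (h12 : t1 ≤ t2)
    (h2 : t2 ≤ 0) : (Set.range fun u => θ u t2) ⊆ Set.range fun u => θ u t1 := by
  rintro _ ⟨u2, rfl⟩
  by_contra hα
  set α := θ u2 t2 with hαd
  have hc : Continuous fun u => θ u t1 := ra_slice D.cθ (h12.trans h2)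
  have hcon : IsPreconnected (Set.range fun u => θ u t1) := isPreconnected_range hc
  have hne : ∀ u, θ u t1 ≠ α := fun u h => hα ⟨u, h⟩
  have hdich : (∀ u, θ u t1 < α) ∨ (∀ u, α < θ u t1) := by
    by_contra hcon'
    push Not at hcon'
    obtain ⟨⟨a, ha⟩, ⟨b, hb⟩⟩ := hcon'
    exact hα (hcon.ordConnected.out ⟨b, rfl⟩ ⟨a, rfl⟩ ⟨hb, ha⟩)
  rcases hdich with h | h
  · have := ra_lemC (D.shift α) h12 h2 (fun u => by linarith [h u]) u2
    simp [hαd] at this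
  · have := ra_lemC (D.shift α).neg h12 h2 (fun u => by linarith [h u]) u2
    simp [hαd] at this

/-- Spatial derivative on the space-time domain. -/
def raDu (F : ℝ × ℝ → ℝ) (p : ℝ × ℝ) : ℝ := fderivWithin ℝ F RAS p (1, 0)

/-- Time derivative on the space-time domain. -/
def raDt (F : ℝ × ℝ → ℝ) (p : ℝ × ℝ) : ℝ := fderivWithin ℝ F RAS p (0, 1)

lemma ra_uniq : UniqueDiffOn ℝ RAS := uniqueDiffOn_univ.prod (uniqueDiffOn_Iic 0)

lemma ra_Du_smooth {F : ℝ × ℝ → ℝ} (hF : ContDiffOn ℝ (⊤ : ℕ∞) F RAS) :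
    ContDiffOn ℝ (⊤ : ℕ∞) (raDu F) RAS :=
  (hF.fderivWithin ra_uniq (m := (⊤ : ℕ∞)) (by simp)).clm_apply contDiffOn_const

lemma ra_Dt_smooth {F : ℝ × ℝ → ℝ} (hF : ContDiffOn ℝ (⊤ : ℕ∞) F RAS) :
    ContDiffOn ℝ (⊤ : ℕ∞) (raDt F) RAS :=
  (hF.fderivWithin ra_uniq (m := (⊤ : ℕ∞)) (by simp)).clm_apply contDiffOn_const

lemma ra_hasDu {F : ℝ × ℝ → ℝ} (hF : ContDiffOn ℝ (⊤ : ℕ∞) F RAS) (u : ℝ) {t : ℝ} (ht : t ≤ 0) :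
    HasDerivAt (fun x => F (x, t)) (raDu F (u, t)) u := by
  have h1 : HasFDerivWithinAt F (fderivWithin ℝ F RAS (u, t)) RAS (u, t) :=
    ((hF.differentiableOn (by simp)) (u, t) ⟨mem_univ _, ht⟩).hasFDerivWithinAt
  have h2 : HasDerivAt (fun x : ℝ => ((x, t) : ℝ × ℝ)) (1, 0) u :=
    (hasDerivAt_id u).prodMk (hasDerivAt_const u t)
  have h3 : ∀ᶠ x in nhds u, ((x, t) : ℝ × ℝ) ∈ RAS :=
    Eventually.of_forall fun x => ⟨mem_univ _, ht⟩
  exact h1.comp_hasDerivAt u h2 h3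

lemma ra_hasDt {F : ℝ × ℝ → ℝ} (hF : ContDiffOn ℝ (⊤ : ℕ∞) F RAS) (u : ℝ) {t : ℝ} (ht : t ≤ 0) :
    HasDerivWithinAt (fun s => F (u, s)) (raDt F (u, t)) (Iic 0) t := by
  have h1 : HasFDerivWithinAt F (fderivWithin ℝ F RAS (u, t)) RAS (u, t) :=
    ((hF.differentiableOn (by simp)) (u, t) ⟨mem_univ _, ht⟩).hasFDerivWithinAt
  have h2 : HasDerivWithinAt (fun x : ℝ => ((u, x) : ℝ × ℝ)) (0, 1) (Iic 0) t :=
    (hasDerivWithinAt_const t _ u).prodMk (hasDerivWithinAt_id t _)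
  exact h1.comp_hasDerivWithinAt t h2 (fun s hs => ⟨mem_univ _, hs⟩)

lemma ra_symm {F : ℝ × ℝ → ℝ} (hF : ContDiffOn ℝ (⊤ : ℕ∞) F RAS) {p : ℝ × ℝ} (hp : p ∈ RAS) :
    raDt (raDu F) p = raDu (raDt F) p := by
  have hs : IsSymmSndFDerivWithinAt ℝ F RAS p := by
    refine (hF p hp).isSymmSndFDerivWithinAt (by
      rw [minSmoothness_of_isRCLikeNormedField]
      exact WithTop.coe_le_coe.2 (le_top : (2 : ℕ∞) ≤ ⊤)) ra_uniq ?_ hp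
    rw [interior_prod_eq, interior_univ, interior_Iic, closure_prod_eq, closure_univ, closure_Iio]
    exact hp
  have hd : DifferentiableWithinAt ℝ (fderivWithin ℝ F RAS) RAS p :=
    ((hF.fderivWithin ra_uniq (m := (⊤ : ℕ∞)) (by simp)).differentiableOn (by simp)) p hp
  have e : ∀ w z : ℝ × ℝ, fderivWithin ℝ (fun q => fderivWithin ℝ F RAS q w) RAS p z =
      fderivWithin ℝ (fderivWithin ℝ F RAS) RAS p z w := by
    intro w z
    rw [fderivWithin_clm_apply (ra_uniq p hp) hd (differentiableWithinAt_const _)]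
    simp
  unfold raDt raDu
  rw [e, e]
  exact hs.eq _ _

lemma ra_coord {f : ℝ → R2} {f' : R2} {s : Set ℝ} {t : ℝ} (h : HasDerivWithinAt f f' s t)
    (i : Fin 2) : HasDerivWithinAt (fun x => f x i) (f' i) s t :=
  ((EuclideanSpace.proj (𝕜 := ℝ) i).hasFDerivAt.comp_hasDerivWithinAt t h)

lemma ra_toR2_0 (x y : ℝ) : toR2 x y 0 = x := rfl
lemma ra_toR2_1 (x y : ℝ) : toR2 x y 1 = y := rfl

lemma ra_toR2_deriv {f g : ℝ → ℝ} {f' g' x : ℝ} (hf : HasDerivAt f f' x) (hg : HasDerivAt g g' x) :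
    HasDerivAt (fun y => toR2 (f y) (g y)) (toR2 f' g') x := by
  have h : HasDerivAt (fun y => ![f y, g y]) ![f', g'] x := by
    rw [hasDerivAt_pi]
    intro i
    fin_cases i
    · exact hf
    · exact hg
  exact ((PiLp.continuousLinearEquiv 2 ℝ (fun _ : Fin 2 => ℝ)).symm.hasFDerivAt.comp_hasDerivAt x h)

lemma ra_data (γ : ℝ → ℝ → R2) (θ : ℝ → ℝ → ℝ) (hcsf : IsCSF γ (Iic 0))
    (hproper : ∀ t ∈ Iic (0:ℝ), IsProperMap fun u => γ u t)
    (hθ : ContDiffOn ℝ (⊤ : ℕ∞) (fun p : ℝ × ℝ => θ p.1 p.2) (univ ×ˢ Iic 0))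
    (hangle : ∀ (u : ℝ), ∀ t ∈ Iic (0:ℝ),
      unitT γ u t = toR2 (Real.cos (θ u t)) (Real.sin (θ u t))) :
    ∃ v κ k1 v1 : ℝ → ℝ → ℝ, RAData v θ κ k1 v1 := by
  obtain ⟨Θ, hΘ⟩ : ∃ Θ : ℝ × ℝ → ℝ, Θ = fun p : ℝ × ℝ => θ p.1 p.2 := ⟨_, rfl⟩
  obtain ⟨X, hX⟩ : ∃ X : ℝ × ℝ → ℝ, X = fun p : ℝ × ℝ => γ p.1 p.2 0 := ⟨_, rfl⟩
  obtain ⟨Y, hY⟩ : ∃ Y : ℝ × ℝ → ℝ, Y = fun p : ℝ × ℝ => γ p.1 p.2 1 := ⟨_, rfl⟩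
  have sΘ : ContDiffOn ℝ (⊤ : ℕ∞) Θ RAS := by rw [hΘ]; exact hθ
  have sX : ContDiffOn ℝ (⊤ : ℕ∞) X RAS := by
    rw [hX]; exact (EuclideanSpace.proj (𝕜 := ℝ) (0 : Fin 2)).contDiff.comp_contDiffOn hcsf.smooth
  have sY : ContDiffOn ℝ (⊤ : ℕ∞) Y RAS := by
    rw [hY]; exact (EuclideanSpace.proj (𝕜 := ℝ) (1 : Fin 2)).contDiff.comp_contDiffOn hcsf.smooth
  have eΘ : ∀ u t, Θ (u, t) = θ u t := fun u t => by rw [hΘ]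
  have sγ : ∀ t, t ≤ 0 → ContDiff ℝ (⊤ : ℕ∞) (fun x => γ x t) := by
    intro t ht
    have h2 : ContDiff ℝ (⊤ : ℕ∞) (fun x : ℝ => ((x, t) : ℝ × ℝ)) := by fun_prop
    exact contDiffOn_univ.1 (hcsf.smooth.comp h2.contDiffOn fun x _ => ⟨mem_univ _, ht⟩)
  have dγ : ∀ u t, t ≤ 0 → HasDerivAt (fun x => γ x t) (deriv (fun x => γ x t) u) u := fun u t ht =>
    ((sγ t ht).differentiable (by simp) u).hasDerivAt
  obtain ⟨N, hN⟩ : ∃ N : ℝ → ℝ → ℝ, N = fun u t => ‖deriv (fun x => γ x t) u‖ := ⟨_, rfl⟩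
  have N0 : ∀ u t, t ≤ 0 → 0 < N u t := fun u t ht => by
    rw [hN]; exact norm_pos_iff.2 (hcsf.regular u t ht)
  -- spatial derivative of the curve
  have eγ : ∀ u t, t ≤ 0 → deriv (fun x => γ x t) u =
      N u t • toR2 (Real.cos (θ u t)) (Real.sin (θ u t)) := by
    intro u t ht
    have h := hangle u t ht
    have hn := (N0 u t ht).ne'
    rw [← h]
    simp only [unitT, aderiv]
    rw [hN] at hn ⊢
    simp only at hn ⊢
    rw [smul_smul, mul_inv_cancel₀ hn, one_smul]
  have eXu : ∀ u t, t ≤ 0 → raDu X (u, t) = N u t * Real.cos (θ u t) := by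
    intro u t ht
    have h1 := ra_hasDu sX u ht
    have h2 := ra_coord ((dγ u t ht).hasDerivWithinAt (s := univ)) 0
    rw [hasDerivWithinAt_univ, eγ u t ht] at h2
    rw [hX] at h1 ⊢
    exact h1.unique h2
  have eYu : ∀ u t, t ≤ 0 → raDu Y (u, t) = N u t * Real.sin (θ u t) := by
    intro u t ht
    have h1 := ra_hasDu sY u ht
    have h2 := ra_coord ((dγ u t ht).hasDerivWithinAt (s := univ)) 1
    rw [hasDerivWithinAt_univ, eγ u t ht] at h2
    rw [hY] at h1 ⊢
    exact h1.unique h2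
  obtain ⟨V, hV⟩ : ∃ V : ℝ × ℝ → ℝ, V = fun p =>
    raDu X p * Real.cos (Θ p) + raDu Y p * Real.sin (Θ p) := ⟨_, rfl⟩
  have sV : ContDiffOn ℝ (⊤ : ℕ∞) V RAS := by
    rw [hV]
    exact ((ra_Du_smooth sX).mul (Real.contDiff_cos.comp_contDiffOn sΘ)).add
      ((ra_Du_smooth sY).mul (Real.contDiff_sin.comp_contDiffOn sΘ))
  have eV : ∀ u t, t ≤ 0 → V (u, t) = N u t := by
    intro u t ht
    rw [hV]
    simp only [eXu u t ht, eYu u t ht, eΘ]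
    linear_combination (N u t) * Real.sin_sq_add_cos_sq (θ u t)
  have V0 : ∀ p ∈ RAS, 0 < V p := by
    rintro ⟨u, t⟩ hp
    rw [eV u t hp.2]; exact N0 u t hp.2
  obtain ⟨κ, hκ⟩ : ∃ κ : ℝ × ℝ → ℝ, κ = fun p => raDu Θ p / V p := ⟨_, rfl⟩
  have sκ : ContDiffOn ℝ (⊤ : ℕ∞) κ RAS := by
    rw [hκ]
    exact (ra_Du_smooth sΘ).div sV fun p hp => (V0 p hp).ne'
  have eκ : ∀ p ∈ RAS, raDu Θ p = κ p * V p := by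
    intro p hp
    have := (V0 p hp).ne'
    rw [hκ]; field_simp
  -- the flow equation
  have flow : ∀ u t, t ≤ 0 → derivWithin (fun s => γ u s) (Iic 0) t =
      toR2 (-(κ (u, t) * Real.sin (θ u t))) (κ (u, t) * Real.cos (θ u t)) := by
    intro u t ht
    rw [hcsf.flow u t ht]
    have e1 : (fun x => aderiv γ γ x t) =
        fun x => toR2 (Real.cos (θ x t)) (Real.sin (θ x t)) := funext fun x => hangle x t ht
    have hd := ra_hasDu sΘ u ht
    simp only [eΘ] at hd
    have e2 := (ra_toR2_deriv hd.cos hd.sin).deriv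
    have hmem : (u, t) ∈ RAS := ⟨mem_univ _, ht⟩
    unfold aderiv at e1 ⊢
    rw [e1, e2, eκ _ hmem]
    have hn := (N0 u t ht).ne'
    have e3 : ‖deriv (fun v => γ v t) u‖ = N u t := by rw [hN]
    rw [e3, eV u t ht]
    ext i
    fin_cases i
    · show (N u t)⁻¹ * (-Real.sin (θ u t) * (κ (u, t) * N u t)) = -(κ (u, t) * Real.sin (θ u t))
      field_simp
    · show (N u t)⁻¹ * (Real.cos (θ u t) * (κ (u, t) * N u t)) = κ (u, t) * Real.cos (θ u t)
      field_simp
  have dtγ : ∀ u t, t ≤ 0 → HasDerivWithinAt (fun s => γ u s)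
      (toR2 (-(κ (u, t) * Real.sin (θ u t))) (κ (u, t) * Real.cos (θ u t))) (Iic 0) t := by
    intro u t ht
    rw [← flow u t ht]
    have h2 : ContDiff ℝ (⊤ : ℕ∞) (fun x : ℝ => ((u, x) : ℝ × ℝ)) := by fun_prop
    have h3 : ContDiffOn ℝ (⊤ : ℕ∞) (fun s => γ u s) (Iic 0) :=
      hcsf.smooth.comp h2.contDiffOn fun x hx => ⟨mem_univ _, hx⟩
    exact ((h3.differentiableOn (by simp)) t ht).hasDerivWithinAt
  have uq : ∀ t : ℝ, t ≤ 0 → UniqueDiffWithinAt ℝ (Iic (0:ℝ)) t := fun t ht => uniqueDiffOn_Iic 0 t ht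
  have eXt : ∀ u t, t ≤ 0 → raDt X (u, t) = -(κ (u, t) * Real.sin (θ u t)) := by
    intro u t ht
    have h1 := ra_hasDt sX u ht
    have h2 := ra_coord (dtγ u t ht) 0
    rw [hX] at h1 ⊢
    exact (uq t ht).eq_deriv _ h1 h2
  have eYt : ∀ u t, t ≤ 0 → raDt Y (u, t) = κ (u, t) * Real.cos (θ u t) := by
    intro u t ht
    have h1 := ra_hasDt sY u ht
    have h2 := ra_coord (dtγ u t ht) 1
    rw [hY] at h1 ⊢
    exact (uq t ht).eq_deriv _ h1 h2
  -- mixed partials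
  have mixed : ∀ u t, t ≤ 0 → raDt V (u, t) = -(κ (u, t) ^ 2 * V (u, t)) ∧
      raDt Θ (u, t) = raDu κ (u, t) / V (u, t) := by
    intro u t ht
    have hmem : (u, t) ∈ RAS := ⟨mem_univ _, ht⟩
    have dΘu := ra_hasDu sΘ u ht
    have dΘt := ra_hasDt sΘ u ht
    simp only [eΘ] at dΘu dΘt
    have dκu := ra_hasDu sκ u ht
    have dVt := ra_hasDt sV u ht
    have x1 : raDt (raDu X) (u, t) = raDt V (u, t) * Real.cos (θ u t)
        + V (u, t) * (-Real.sin (θ u t) * raDt Θ (u, t)) := by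
      refine (uq t ht).eq_deriv _ (ra_hasDt (ra_Du_smooth sX) u ht) ?_
      refine (dVt.mul dΘt.cos).congr (fun s hs => ?_) ?_
      · rw [eXu u s hs, Pi.mul_apply, eV u s hs]
      · rw [eXu u t ht, Pi.mul_apply, eV u t ht]
    have y1 : raDt (raDu Y) (u, t) = raDt V (u, t) * Real.sin (θ u t)
        + V (u, t) * (Real.cos (θ u t) * raDt Θ (u, t)) := by
      refine (uq t ht).eq_deriv _ (ra_hasDt (ra_Du_smooth sY) u ht) ?_
      refine (dVt.mul dΘt.sin).congr (fun s hs => ?_) ?_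
      · rw [eYu u s hs, Pi.mul_apply, eV u s hs]
      · rw [eYu u t ht, Pi.mul_apply, eV u t ht]
    have x2 : raDu (raDt X) (u, t) = -(raDu κ (u, t) * Real.sin (θ u t)
        + κ (u, t) * (Real.cos (θ u t) * raDu Θ (u, t))) := by
      refine (ra_hasDu (ra_Dt_smooth sX) u ht).unique ?_
      have e : (fun x => raDt X (x, t)) = fun x => -(κ (x, t) * Real.sin (θ x t)) :=
        funext fun x => eXt x t ht
      rw [e]
      exact (dκu.mul dΘu.sin).neg
    have y2 : raDu (raDt Y) (u, t) = raDu κ (u, t) * Real.cos (θ u t)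
        + κ (u, t) * (-Real.sin (θ u t) * raDu Θ (u, t)) := by
      refine (ra_hasDu (ra_Dt_smooth sY) u ht).unique ?_
      have e : (fun x => raDt Y (x, t)) = fun x => κ (x, t) * Real.cos (θ x t) :=
        funext fun x => eYt x t ht
      rw [e]
      exact dκu.mul dΘu.cos
    rw [ra_symm sX hmem, x2, eκ _ hmem] at x1
    rw [ra_symm sY hmem, y2, eκ _ hmem] at y1
    have cs := Real.sin_sq_add_cos_sq (θ u t)
    have hv := (V0 _ hmem).ne'
    constructor
    · linear_combination (-Real.cos (θ u t)) * x1 - Real.sin (θ u t) * y1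
        - (raDt V (u, t) + κ (u, t) ^ 2 * V (u, t)) * cs
    · rw [eq_div_iff hv]
      linear_combination (Real.sin (θ u t)) * x1 - Real.cos (θ u t) * y1
        - (raDt Θ (u, t) * V (u, t) - raDu κ (u, t)) * cs
  -- length
  have len : ∀ t, t ≤ 0 → ∀ a b, a ≤ b → ‖γ b t - γ a t‖ ≤ ∫ x in a..b, V (x, t) := by
    intro t ht a b hab
    have hc : Continuous (deriv (fun x => γ x t)) := (sγ t ht).continuous_deriv (by simp)
    have e := intervalIntegral.integral_eq_sub_of_hasDerivAt (a := a) (b := b)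
      (fun x _ => dγ x t ht) (hc.intervalIntegrable _ _)
    rw [← e]
    refine (intervalIntegral.norm_integral_le_integral_norm hab).trans (le_of_eq ?_)
    refine intervalIntegral.integral_congr fun x _ => ?_
    simp only [eV x t ht, hN]
  have tn : ∀ t, t ≤ 0 → ∀ a, Tendsto (fun b => ‖γ b t - γ a t‖) (cocompact ℝ) atTop := by
    intro t ht a
    have h1 : Tendsto (fun u => γ u t) (cocompact ℝ) (cocompact R2) :=
      (isProperMap_iff_tendsto_cocompact.1 (hproper t ht)).2
    have h2 : Tendsto (fun u => ‖γ u t‖) (cocompact ℝ) atTop :=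
      (tendsto_norm_cocompact_atTop (E := R2)).comp h1
    refine tendsto_atTop_mono (fun b => norm_sub_norm_le (γ b t) (γ a t)) ?_
    exact tendsto_atTop_add_const_right _ (-‖γ a t‖) h2
  refine ⟨fun u t => V (u, t), fun u t => κ (u, t), fun u t => raDu κ (u, t),
    fun u t => raDu V (u, t), ⟨sV.continuousOn, hθ.continuousOn, sκ.continuousOn,
    (ra_Du_smooth sκ).continuousOn, (ra_Du_smooth sV).continuousOn,
    fun u t ht => V0 (u, t) ⟨mem_univ _, ht⟩, ?_, fun u t ht => ra_hasDu sκ u ht,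
    fun u t ht => ra_hasDu sV u ht, ?_, ?_, ?_, ?_⟩⟩
  · intro u t ht
    have h := ra_hasDu sΘ u ht
    rw [eκ (u, t) ⟨mem_univ _, ht⟩] at h
    simpa only [eΘ] using h
  · intro u t ht
    have h := ra_hasDt sΘ u ht
    rw [(mixed u t ht).2] at h
    simpa only [eΘ] using h
  · intro u t ht
    have h := ra_hasDt sV u ht
    rwa [(mixed u t ht).1] at h
  · intro t ht a C
    have h := (tn t ht a).mono_left (atTop_le_cocompact)
    obtain ⟨b, hb1, hb2⟩ := ((h.eventually_gt_atTop C).and (eventually_gt_atTop a)).exists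
    exact ⟨b, hb2, hb1.trans_le (len t ht a b hb2.le)⟩
  · intro t ht a C
    have h := (tn t ht a).mono_left (atBot_le_cocompact)
    obtain ⟨b, hb1, hb2⟩ := ((h.eventually_gt_atTop C).and (eventually_lt_atBot a)).exists
    refine ⟨b, hb2, hb1.trans_le ?_⟩
    rw [norm_sub_rev]
    exact len t ht b a hb2.le

/-- For an ancient complete non-compact embedded smooth curve shortening
flow with smooth angle function `θ`, the range of the angle is non-increasing in time. -/
theorem range_angle_antitone
    (γ : ℝ → ℝ → R2) (θ : ℝ → ℝ → ℝ)
    (hcsf : IsCSF γ (Iic 0))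
    (hemb : ∀ t ∈ Iic (0:ℝ), Function.Injective fun u => γ u t)
    (hproper : ∀ t ∈ Iic (0:ℝ), IsProperMap fun u => γ u t)
    (hθ : ContDiffOn ℝ (⊤ : ℕ∞) (fun p : ℝ × ℝ => θ p.1 p.2) (univ ×ˢ Iic 0))
    (hangle : ∀ (u : ℝ), ∀ t ∈ Iic (0:ℝ),
      unitT γ u t = toR2 (Real.cos (θ u t)) (Real.sin (θ u t))) :
    ∀ t₁ t₂ : ℝ, t₁ < t₂ → t₂ ≤ 0 →
      (Set.range fun u => θ u t₂) ⊆ Set.range fun u => θ u t₁ := by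
  intro t₁ t₂ h12 h2
  obtain ⟨v, κ, k1, v1, D⟩ := ra_data γ θ hcsf hproper hθ hangle
  exact ra_final D h12.le h2
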